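/- (Lemma 4: residuum bounds.) Let Assumptions 1–5 hold, let (x_s,u_s)∈Z be a steady-state (f(x_s,u_s)=x_s, h_s:=h(x_s,u_s)≤0 componentwise), and assume both the value function J*_N and the rotated value function J̃*_N are attained by unique minimizers u*_{N,x,H} and ũ*_{N,x,H} for every horizon and every initial condition in X×𝕳. Then there exist N₂,N₅∈ℕ, R₁,R₂∈K∞ and σ̃_T∈L_ℕ such that for all (x,H)∈X×𝕳 and all N≥N₅, with ε := σ̃_T(N−N₂−T(2T−1)), there exists k_x∈{T−1,…,N−N₂} such that ‖(x_{u*}(k,x)−x_s, u*(k)−u_s)‖≤ε and ‖(x_{ũ*}(k,x)−x_s, ũ*(k)−u_s)‖≤ε for all k∈{k_x−T+1,…,k_x} (where u*=u*_{N,x,H}, ũ*=ũ*_{N,x,H}), and moreover, with J_{k_x} := Σ_{k=0}^{k_x−1} ℓ(x_{u*}(k,x),u*(k)) and J̃_{k_x} := Σ_{k=0}^{k_x−1} ℓ̃(x_{ũ*}(k,x),ũ*(k)) + k_x·ℓ_s − λ(x): (i) |J*_N(x,H) − J_{k_x} − J*_{N−k_x}(x_s,H^s)| ≤ R₁(ε);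 (ii) J_{k_x} − J̃_{k_x} ≤ ψ(x,H) + R₂(ε); (iii) J̃_{k_x} − J_{k_x} ≤ (T−1)·‖λ̄‖·L_h·ε + R₂(ε). -/

import Mathlib

open Finset Filter
open scoped Classical

noncomputable section

namespace EMPC

abbrev Vec (n : ℕ) : Type := EuclideanSpace ℝ (Fin n)

variable {n m p : ℕ}

/-- Trajectory of the discrete-time system `x(k+1) = f(x(k), u(k))`. -/
def traj (f : Vec n → Vec m → Vec n) (x : Vec n) (u : ℕ → Vec m) : ℕ → Vec n
  | 0 => x
  | k + 1 => f (traj f x u k) (u k)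

/-- Open-loop cost `J_N(x,u)`. -/
def cost (f : Vec n → Vec m → Vec n) (ℓ : Vec n → Vec m → ℝ) (x : Vec n)
    (u : ℕ → Vec m) (N : ℕ) : ℝ :=
  ∑ k ∈ Finset.range N, ℓ (traj f x u k) (u k)

/-- Admissibility `u ∈ U^N(x,H)` for the transient average constrained problem. -/
def Admissible (f : Vec n → Vec m → Vec n) (h : Vec n → Vec m → Vec p)
    (Z : Set (Vec n × Vec m)) (T N : ℕ) (x : Vec n) (H : ℕ → Vec p)
    (u : ℕ → Vec m) : Prop :=
  (∀ k < N, (traj f x u k, u k) ∈ Z) ∧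
  (∀ j ∈ Finset.Icc 1 (T - 1), ∀ i : Fin p,
    (∑ l ∈ Finset.Icc j (T - 1), H l i)
      + ∑ k ∈ Finset.range j, h (traj f x u k) (u k) i ≤ 0) ∧
  (∀ s : ℕ, s + T ≤ N → ∀ i : Fin p,
    ∑ k ∈ Finset.Ico s (s + T), h (traj f x u k) (u k) i ≤ 0)

/-- Class `K∞` comparison functions. -/
def KInf (α : ℝ → ℝ) : Prop :=
  ContinuousOn α (Set.Ici 0) ∧ StrictMonoOn α (Set.Ici 0) ∧ α 0 = 0 ∧
    Tendsto α atTop atTop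

/-- Class `L_ℕ`: decreasing functions on ℕ with limit 0. -/
def LN (δ : ℕ → ℝ) : Prop :=
  Antitone δ ∧ (∀ k, 0 ≤ δ k) ∧ Tendsto δ atTop (nhds 0)

/-- Class `KLS`. -/
def KLS (β : ℝ → ℕ → ℝ) : Prop :=
  (∀ k : ℕ, ContinuousOn (fun r => β r k) (Set.Ici 0) ∧
    StrictMonoOn (fun r => β r k) (Set.Ici 0) ∧ β 0 k = 0) ∧
  (∀ r : ℝ, 0 ≤ r → LN (fun k => β r k)) ∧
  (∀ r : ℝ, 0 ≤ r → Summable (fun k => β r k)) ∧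
  (ContinuousOn (fun r => ∑' k, β r k) (Set.Ici 0) ∧
    StrictMonoOn (fun r => ∑' k, β r k) (Set.Ici 0) ∧ (∑' k, β 0 k) = 0)

/-- Class `KL`. -/
def KLcl (β : ℝ → ℝ → ℝ) : Prop :=
  ContinuousOn (fun q : ℝ × ℝ => β q.1 q.2) (Set.Ici 0 ×ˢ Set.Ici 0) ∧
  (∀ s : ℝ, 0 ≤ s → StrictMonoOn (fun r => β r s) (Set.Ici 0) ∧ β 0 s = 0) ∧
  (∀ r : ℝ, 0 ≤ r → AntitoneOn (fun s => β r s) (Set.Ici 0) ∧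
    Tendsto (fun s => β r s) atTop (nhds 0)) ∧
  (∀ r s : ℝ, 0 ≤ r → 0 ≤ s → 0 ≤ β r s)

/-- ℓ¹-norm of a vector. -/
def l1 (v : Vec p) : ℝ := ∑ i, |v i|

/-- `Ĥ_k = Σ_i max{H_{ik}, 0}`. -/
def hatCol (H : ℕ → Vec p) (k : ℕ) : ℝ := ∑ i, max (H k i) 0

/-- Norm-like measure `⟨H⟩ = max_{k ∈ {1,…,T-1}} Ĥ_k`. -/
def measH (T : ℕ) (H : ℕ → Vec p) : ℝ := ⨆ k ∈ Finset.Icc 1 (T - 1), hatCol H k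

/-- `‖H‖₁ = max_{k ∈ {1,…,T-1}} ‖H_k‖₁`. -/
def norm1H (T : ℕ) (H : ℕ → Vec p) : ℝ := ⨆ k ∈ Finset.Icc 1 (T - 1), l1 (H k)

/-- The set `𝕳` of feasible stored outputs. -/
def HSet (h : Vec n → Vec m → Vec p) (Z : Set (Vec n × Vec m)) (T : ℕ) :
    Set (ℕ → Vec p) :=
  {H | ∀ k ∈ Finset.Icc 1 (T - 1), ∀ i : Fin p,
    sInf ((fun z : Vec n × Vec m => h z.1 z.2 i) '' Z) ≤ H k i ∧
    H k i ≤ sSup ((fun z : Vec n × Vec m => h z.1 z.2 i) '' Z)}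

/-- Value function `J*_N(x,H)`. -/
def Jstar (f : Vec n → Vec m → Vec n) (ℓ : Vec n → Vec m → ℝ)
    (h : Vec n → Vec m → Vec p) (Z : Set (Vec n × Vec m)) (T N : ℕ)
    (x : Vec n) (H : ℕ → Vec p) : ℝ :=
  sInf ((fun u => cost f ℓ x u N) '' {u | Admissible f h Z T N x H u})

/-- Rotated stage cost `ℓ̃`. -/
def rot (f : Vec n → Vec m → Vec n) (ℓ : Vec n → Vec m → ℝ)
    (h : Vec n → Vec m → Vec p) (ℓs : ℝ) (lam : Vec n → ℝ) (lb : Vec p)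
    (x : Vec n) (u : Vec m) : ℝ :=
  ℓ x u - ℓs + lam x - lam (f x u) + ∑ i, lb i * h x u i

/-- Rotated open-loop cost. -/
def rcost (f : Vec n → Vec m → Vec n) (ℓ : Vec n → Vec m → ℝ)
    (h : Vec n → Vec m → Vec p) (ℓs : ℝ) (lam : Vec n → ℝ) (lb : Vec p)
    (x : Vec n) (u : ℕ → Vec m) (N : ℕ) : ℝ :=
  ∑ k ∈ Finset.range N, rot f ℓ h ℓs lam lb (traj f x u k) (u k)

/-- Rotated value function `J̃*_N(x,H)`. -/
def Jtstar (f : Vec n → Vec m → Vec n) (ℓ : Vec n → Vec m → ℝ)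
    (h : Vec n → Vec m → Vec p) (Z : Set (Vec n × Vec m)) (T : ℕ)
    (ℓs : ℝ) (lam : Vec n → ℝ) (lb : Vec p) (N : ℕ)
    (x : Vec n) (H : ℕ → Vec p) : ℝ :=
  sInf ((fun u => rcost f ℓ h ℓs lam lb x u N) '' {u | Admissible f h Z T N x H u})

/-- `k_{T,N} = ⌈N/T⌉·T − N`. -/
def kTN (T N : ℕ) : ℕ := ((N + T - 1) / T) * T - N

/-- The stored-output matrix along a trajectory, starting at time `d`
(column `k ∈ {1,…,T-1}` is the auxiliary output at time `d + k - 1`). -/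
def storedH (f : Vec n → Vec m → Vec n) (h : Vec n → Vec m → Vec p)
    (x : Vec n) (u : ℕ → Vec m) (d : ℕ) : ℕ → Vec p :=
  fun k => h (traj f x u (d + k - 1)) (u (d + k - 1))

/-- Local controllability (Assumption 4). -/
def LocCtrl (f : Vec n → Vec m → Vec n) (h : Vec n → Vec m → Vec p)
    (Z : Set (Vec n × Vec m)) (T : ℕ) (xs : Vec n) (δc Eh : ℝ) (d : ℕ)
    (γx γu : ℝ → ℝ) : Prop :=
  ∀ (xc : Vec n) (Hc : ℕ → Vec p) (uc : ℕ → Vec m),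
    Admissible f h Z T (d + T) xc Hc uc →
    measH T Hc ≤ Eh →
    (∀ k ≤ d + T, ‖traj f xc uc k - xs‖ ≤ δc) →
    ∀ (N₁ : ℕ) (x₁ : Vec n) (H₁ : ℕ → Vec p) (u₁ : ℕ → Vec m),
      d + T ≤ N₁ → x₁ ∈ Prod.fst '' Z → H₁ ∈ HSet h Z T →
      Admissible f h Z T N₁ x₁ H₁ u₁ →
      measH T (fun k => storedH f h x₁ u₁ d k - storedH f h xc uc d k) ≤ Eh →
      ‖traj f x₁ u₁ d - xs‖ ≤ δc →
      ∀ (x₂ : Vec n) (H₂ : ℕ → Vec p),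
        ‖x₂ - xs‖ ≤ δc → measH T (fun k => H₂ k - Hc k) ≤ Eh →
        ∃ u₂ : ℕ → Vec m,
          Admissible f h Z T d x₂ H₂ u₂ ∧
          traj f x₂ u₂ d = traj f x₁ u₁ d ∧
          Admissible f h Z T N₁ x₂ H₂ (fun k => if k < d then u₂ k else u₁ k) ∧
          ∀ k ≤ d,
            ‖traj f x₂ u₂ k - traj f xc uc k‖ ≤
              γx (max (‖x₂ - xc‖ + measH T (fun j => H₂ j - Hc j))
                (‖traj f x₁ u₁ d - traj f xc uc d‖ +
                  measH T (fun j => storedH f h x₁ u₁ d j - storedH f h xc uc d j))) ∧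
            ‖u₂ k - uc k‖ ≤
              γu (max (‖x₂ - xc‖ + measH T (fun j => H₂ j - Hc j))
                (‖traj f x₁ u₁ d - traj f xc uc d‖ +
                  measH T (fun j => storedH f h x₁ u₁ d j - storedH f h xc uc d j)))

/-- Shift dynamics of the stored outputs: `f_H(H, y) = [H_2, …, H_{T-1}, y]`. -/
def shiftH (T : ℕ) (H : ℕ → Vec p) (y : Vec p) : ℕ → Vec p :=
  fun k => if k + 1 < T then H (k + 1) else if k + 1 = T then y else H k

/-- Closed-loop trajectory of the extended state `χ = (x, H)` under the MPC
feedback `μ_N(x,H) = u*_{N,x,H}(0)`. -/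
def clTraj (f : Vec n → Vec m → Vec n) (h : Vec n → Vec m → Vec p)
    (ustar : ℕ → Vec n → (ℕ → Vec p) → ℕ → Vec m) (N T : ℕ)
    (χ : Vec n × (ℕ → Vec p)) : ℕ → Vec n × (ℕ → Vec p)
  | 0 => χ
  | k + 1 =>
    (f (clTraj f h ustar N T χ k).1
        (ustar N (clTraj f h ustar N T χ k).1 (clTraj f h ustar N T χ k).2 0),
      shiftH T (clTraj f h ustar N T χ k).2
        (h (clTraj f h ustar N T χ k).1
          (ustar N (clTraj f h ustar N T χ k).1 (clTraj f h ustar N T χ k).2 0)))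

section helpers

variable {T : ℕ} {f : Vec n → Vec m → Vec n} {ℓ : Vec n → Vec m → ℝ}
  {h : Vec n → Vec m → Vec p} {Z : Set (Vec n × Vec m)}

lemma traj_congr (x : Vec n) {u v : ℕ → Vec m} {k : ℕ} (huv : ∀ j < k, u j = v j) :
    traj f x u k = traj f x v k := by
  induction k with
  | zero => rfl
  | succ k ih =>
    simp only [traj]
    rw [ih (fun j hj => huv j (by omega)), huv k (by omega)]

lemma traj_shift (x : Vec n) (u : ℕ → Vec m) (k l : ℕ) :
    traj f (traj f x u k) (fun j => u (k + j)) l = traj f x u (k + l) := by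
  induction l with
  | zero => rfl
  | succ l ih =>
    rw [← Nat.add_assoc]
    simp only [traj]
    rw [ih]

/-- Concatenation of control sequences. -/
def conc (k : ℕ) (u w : ℕ → Vec m) : ℕ → Vec m := fun j => if j < k then u j else w (j - k)

lemma conc_lt {k j : ℕ} (u w : ℕ → Vec m) (hj : j < k) : conc k u w j = u j := by
  simp [conc, hj]

lemma conc_add (k j : ℕ) (u w : ℕ → Vec m) : conc k u w (k + j) = w j := by
  simp [conc]

lemma traj_conc_le (x : Vec n) (u w : ℕ → Vec m) {k j : ℕ} (hj : j ≤ k) :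
    traj f x (conc k u w) j = traj f x u j :=
  traj_congr x (fun i hi => conc_lt u w (by omega))

lemma traj_conc_add (x : Vec n) (u w : ℕ → Vec m) (k j : ℕ) :
    traj f x (conc k u w) (k + j) = traj f (traj f x u k) w j := by
  rw [← traj_shift, traj_conc_le x u w le_rfl]
  exact traj_congr _ (fun i _ => conc_add k i u w)

lemma sum_conc (G : Vec n → Vec m → ℝ) (x : Vec n) (u w : ℕ → Vec m) (k N : ℕ) :
    ∑ j ∈ range (k + N), G (traj f x (conc k u w) j) (conc k u w j) =
      ∑ j ∈ range k, G (traj f x u j) (u j) +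
      ∑ j ∈ range N, G (traj f (traj f x u k) w j) (w j) := by
  rw [Finset.sum_range_add]
  congr 1
  · apply Finset.sum_congr rfl
    intro j hj
    have := Finset.mem_range.1 hj
    rw [traj_conc_le x u w this.le, conc_lt u w this]
  · apply Finset.sum_congr rfl
    intro j hj
    rw [traj_conc_add, conc_add]

lemma sum_shift (G : Vec n → Vec m → ℝ) (x : Vec n) (u : ℕ → Vec m) (k N : ℕ) :
    ∑ j ∈ range (k + N), G (traj f x u j) (u j) =
      ∑ j ∈ range k, G (traj f x u j) (u j) +
      ∑ j ∈ range N, G (traj f (traj f x u k) (fun j => u (k + j)) j) (u (k + j)) := by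
  rw [Finset.sum_range_add]
  congr 1
  apply Finset.sum_congr rfl
  intro j hj
  rw [traj_shift]

/-- Stored outputs just before time `k`. -/
def hist (f : Vec n → Vec m → Vec n) (h : Vec n → Vec m → Vec p) (T : ℕ)
    (x : Vec n) (u : ℕ → Vec m) (k : ℕ) : ℕ → Vec p :=
  fun l => h (traj f x u (k + l - T)) (u (k + l - T))

lemma win (F : ℕ → ℝ) {k j T : ℕ} (hj : 1 ≤ j) (hjT : j ≤ T - 1) (hk : T - 1 ≤ k) :
    ∑ l ∈ Icc j (T - 1), F (k + l - T) + ∑ i ∈ range j, F (k + i) =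
      ∑ i ∈ Ico (k + j - T) (k + j - T + T), F i := by
  have e1 : ∑ l ∈ Icc j (T - 1), F (k + l - T) = ∑ i ∈ Ico (k + j - T) k, F i := by
    apply Finset.sum_bij (fun l _ => k + l - T)
    · intro a ha; simp only [Finset.mem_Icc, Finset.mem_Ico] at *; omega
    · intro a ha b hb hab; simp only [Finset.mem_Icc] at *; omega
    · intro b hb
      simp only [Finset.mem_Ico] at hb
      exact ⟨b + T - k, by simp only [Finset.mem_Icc]; omega, by omega⟩
    · intro a _; rfl
  have e2 : ∑ i ∈ range j, F (k + i) = ∑ i ∈ Ico k (k + j), F i := by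
    rw [Finset.sum_Ico_eq_sum_range]; simp
  rw [e1, e2, Finset.sum_Ico_consecutive _ (by omega) (by omega)]
  congr 2; omega

lemma adm_tail {N₁ k : ℕ} {x : Vec n} {H : ℕ → Vec p} {u : ℕ → Vec m}
    (ha : Admissible f h Z T (k + N₁) x H u) (hk : T - 1 ≤ k) (hN : T ≤ N₁) :
    Admissible f h Z T N₁ (traj f x u k) (hist f h T x u k) (fun j => u (k + j)) := by
  obtain ⟨a1, a2, a3⟩ := ha
  refine ⟨fun j hj => ?_, fun j hj i => ?_, fun s hs i => ?_⟩
  · rw [traj_shift]; exact a1 _ (by omega)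
  · simp only [traj_shift, hist]
    rw [Finset.mem_Icc] at hj
    rw [win (fun t => h (traj f x u t) (u t) i) hj.1 hj.2 hk]
    exact a3 _ (by omega) i
  · simp only [traj_shift]
    have := a3 (k + s) (by omega) i
    rw [Finset.sum_Ico_eq_sum_range] at this ⊢
    have e : k + s + T - (k + s) = s + T - s := by omega
    rw [e] at this
    simpa [Nat.add_assoc] using this

lemma adm_conc {N₁ k : ℕ} {x : Vec n} {H : ℕ → Vec p} {u w : ℕ → Vec m}
    (ha : Admissible f h Z T (k + N₁) x H u) (hk : T - 1 ≤ k)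
    (hw : Admissible f h Z T N₁ (traj f x u k) (hist f h T x u k) w) :
    Admissible f h Z T (k + N₁) x H (conc k u w) := by
  obtain ⟨a1, a2, a3⟩ := ha
  obtain ⟨b1, b2, b3⟩ := hw
  refine ⟨fun j hj => ?_, fun j hj i => ?_, fun s hs i => ?_⟩
  · by_cases hjk : j < k
    · rw [traj_conc_le x u w hjk.le, conc_lt u w hjk]; exact a1 _ (by omega)
    · obtain ⟨t, rfl⟩ := Nat.exists_eq_add_of_le (not_lt.1 hjk)
      rw [traj_conc_add, conc_add]; exact b1 _ (by omega)
  · have := a2 j hj i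
    rw [Finset.mem_Icc] at hj
    convert this using 2
    apply Finset.sum_congr rfl
    intro t ht
    rw [Finset.mem_range] at ht
    rw [traj_conc_le x u w (by omega), conc_lt u w (by omega)]
  · by_cases h1 : s + T ≤ k
    · have := a3 s (by omega) i
      convert this using 1
      apply Finset.sum_congr rfl
      intro t ht
      rw [Finset.mem_Ico] at ht
      rw [traj_conc_le x u w (by omega), conc_lt u w (by omega)]
    · by_cases h2 : k ≤ s
      · obtain ⟨t, rfl⟩ := Nat.exists_eq_add_of_le h2
        have := b3 t (by omega) i
        rw [Finset.sum_Ico_eq_sum_range] at this ⊢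
        convert this using 1
        have e : k + t + T - (k + t) = t + T - t := by omega
        rw [e]
        apply Finset.sum_congr rfl
        intro r hr
        rw [Nat.add_assoc, traj_conc_add, conc_add]
      · have hj1 : 1 ≤ s + T - k := by omega
        have hj2 : s + T - k ≤ T - 1 := by omega
        have := b2 (s + T - k) (Finset.mem_Icc.2 ⟨hj1, hj2⟩) i
        have hwin := win (fun t => h (traj f x (conc k u w) t) (conc k u w t) i) hj1 hj2 hk
        have e : k + (s + T - k) - T = s := by omega
        rw [e] at hwin
        rw [← hwin]
        convert this using 2
        · apply Finset.sum_congr rfl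
          intro t ht
          rw [Finset.mem_Icc] at ht
          simp only [hist]
          rw [traj_conc_le x u w (by omega), conc_lt u w (by omega)]
        · apply Finset.sum_congr rfl
          intro t ht
          rw [traj_conc_add, conc_add]

lemma traj_const {xs : Vec n} {us : Vec m} (hfix : f xs us = xs) (k : ℕ) :
    traj f xs (fun _ => us) k = xs := by
  induction k with
  | zero => rfl
  | succ k ih => simp only [traj]; rw [ih, hfix]

lemma adm_const {xs : Vec n} {us : Vec m} (hzs : (xs, us) ∈ Z) (hfix : f xs us = xs)
    (hhs : ∀ i, h xs us i ≤ 0) (N : ℕ) :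
    Admissible f h Z T N xs (fun _ => h xs us) (fun _ => us) := by
  refine ⟨fun j hj => ?_, fun j hj i => ?_, fun s hs i => ?_⟩
  · rw [traj_const hfix]; exact hzs
  · simp only [traj_const hfix]
    exact add_nonpos (Finset.sum_nonpos fun _ _ => hhs i) (Finset.sum_nonpos fun _ _ => hhs i)
  · simp only [traj_const hfix]
    exact Finset.sum_nonpos fun _ _ => hhs i

lemma kinf_small {α : ℝ → ℝ} (hα : KInf α) {η : ℝ} (hη : 0 < η) :
    ∃ δ > 0, ∀ r, 0 ≤ r → r ≤ δ → α r ≤ η := by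
  obtain ⟨hc, hm, h0, -⟩ := hα
  have h1 : ContinuousWithinAt α (Set.Ici 0) 0 := hc 0 (by simp)
  rw [Metric.continuousWithinAt_iff] at h1
  obtain ⟨δ, hδ, h2⟩ := h1 η hη
  refine ⟨δ / 2, by positivity, fun r hr hr2 => ?_⟩
  have := h2 (x := r) hr (by rw [Real.dist_eq, sub_zero, abs_of_nonneg hr]; linarith)
  rw [Real.dist_eq, h0, sub_zero] at this
  exact (le_abs_self _).trans this.le

lemma kinf_nonneg {α : ℝ → ℝ} (hα : KInf α) {r : ℝ} (hr : 0 ≤ r) : 0 ≤ α r := by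
  obtain ⟨hc, hm, h0, -⟩ := hα
  rw [← h0]
  exact hm.monotoneOn (by simp) hr hr

lemma kinf_pos {α : ℝ → ℝ} (hα : KInf α) {r : ℝ} (hr : 0 < r) : 0 < α r := by
  obtain ⟨hc, hm, h0, -⟩ := hα
  rw [← h0]
  exact hm (by simp) hr.le hr

lemma kinf_mono {α : ℝ → ℝ} (hα : KInf α) {r s : ℝ} (hr : 0 ≤ r) (hs : r ≤ s) : α r ≤ α s :=
  hα.2.1.monotoneOn hr (hr.trans hs) hs

lemma hatCol_nonneg (H : ℕ → Vec p) (k : ℕ) : 0 ≤ hatCol H k :=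
  Finset.sum_nonneg fun _ _ => le_max_right _ _

lemma measH_nonneg (H : ℕ → Vec p) : 0 ≤ measH T H :=
  Real.iSup_nonneg fun k => Real.iSup_nonneg fun _ => hatCol_nonneg H k

lemma measH_le {H : ℕ → Vec p} {c : ℝ} (hc : 0 ≤ c)
    (hH : ∀ k ∈ Finset.Icc 1 (T - 1), hatCol H k ≤ c) : measH T H ≤ c :=
  Real.iSup_le (fun k => Real.iSup_le (fun hk => hH k hk) hc) hc

lemma coord_le (v : Vec p) (i : Fin p) : |v i| ≤ ‖v‖ := by
  have := PiLp.norm_apply_le v i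
  rwa [Real.norm_eq_abs] at this

lemma hatCol_le (H : ℕ → Vec p) (k : ℕ) {c : ℝ} (hc : 0 ≤ c) (hH : ∀ i, H k i ≤ c) :
    hatCol H k ≤ p * c := by
  unfold hatCol
  have : ∑ i : Fin p, max (H k i) 0 ≤ ∑ i : Fin p, c :=
    Finset.sum_le_sum fun i _ => max_le (hH i) hc
  simpa using this

lemma measH_le_norm {H : ℕ → Vec p} {c : ℝ} (hc : 0 ≤ c)
    (hH : ∀ k ∈ Finset.Icc 1 (T - 1), ‖H k‖ ≤ c) : measH T H ≤ p * c :=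
  measH_le (by positivity) fun k hk => hatCol_le H k hc fun i =>
    (le_abs_self _).trans ((coord_le _ i).trans (hH k hk))

lemma diamZ (hZ : IsCompact Z) (xs : Vec n) (us : Vec m) :
    ∃ D, 0 ≤ D ∧ ∀ z ∈ Z, ‖(z.1 - xs, z.2 - us)‖ ≤ D := by
  obtain ⟨D, hD⟩ := hZ.isBounded.subset_closedBall (xs, us)
  refine ⟨max D 0, le_max_right _ _, fun z hz => ?_⟩
  have := hD hz
  rw [Metric.mem_closedBall, dist_eq_norm] at this
  exact le_max_of_le_left this

section
variable {xs : Vec n} {us : Vec m} {Lh : ℝ}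

lemma h_coord (hhL : ∀ z₁ ∈ Z, ∀ z₂ ∈ Z,
      ‖h z₁.1 z₁.2 - h z₂.1 z₂.2‖ ≤ Lh * ‖(z₁.1 - z₂.1, z₁.2 - z₂.2)‖)
    (hzs : (xs, us) ∈ Z) {z : Vec n × Vec m} (hz : z ∈ Z) (i : Fin p) :
    |h z.1 z.2 i - h xs us i| ≤ Lh * ‖(z.1 - xs, z.2 - us)‖ := by
  have h1 := hhL z hz _ hzs
  have h2 := coord_le (h z.1 z.2 - h xs us) i
  exact h2.trans h1

lemma h_bdd (hZ : IsCompact Z) (hLh : 0 < Lh) (hhL : ∀ z₁ ∈ Z, ∀ z₂ ∈ Z,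
      ‖h z₁.1 z₁.2 - h z₂.1 z₂.2‖ ≤ Lh * ‖(z₁.1 - z₂.1, z₁.2 - z₂.2)‖)
    (hzs : (xs, us) ∈ Z) :
    ∃ D, 0 ≤ D ∧ ∀ z ∈ Z, ∀ i, |h z.1 z.2 i - h xs us i| ≤ D := by
  obtain ⟨D, hD, h1⟩ := diamZ hZ xs us
  refine ⟨Lh * D, by positivity, fun z hz i => (h_coord hhL hzs hz i).trans ?_⟩
  have := h1 z hz
  gcongr

lemma mem_HSet (hZ : IsCompact Z) (hLh : 0 < Lh) (hhL : ∀ z₁ ∈ Z, ∀ z₂ ∈ Z,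
      ‖h z₁.1 z₁.2 - h z₂.1 z₂.2‖ ≤ Lh * ‖(z₁.1 - z₂.1, z₁.2 - z₂.2)‖)
    (hzs : (xs, us) ∈ Z) {H : ℕ → Vec p}
    (hH : ∀ k ∈ Icc 1 (T - 1), ∃ z ∈ Z, H k = h z.1 z.2) : H ∈ HSet h Z T := by
  obtain ⟨D, hD, h1⟩ := h_bdd hZ hLh hhL hzs
  intro k hk i
  obtain ⟨z, hz, e⟩ := hH k hk
  rw [e]
  refine ⟨csInf_le ⟨h xs us i - D, ?_⟩ ⟨z, hz, rfl⟩, le_csSup ⟨h xs us i + D, ?_⟩ ⟨z, hz, rfl⟩⟩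
  · rintro _ ⟨y, hy, rfl⟩
    have := abs_le.1 (h1 y hy i)
    simp only; linarith
  · rintro _ ⟨y, hy, rfl⟩
    have := abs_le.1 (h1 y hy i)
    simp only; linarith

lemma measH_bdd (hZ : IsCompact Z) (hLh : 0 < Lh) (hhL : ∀ z₁ ∈ Z, ∀ z₂ ∈ Z,
      ‖h z₁.1 z₁.2 - h z₂.1 z₂.2‖ ≤ Lh * ‖(z₁.1 - z₂.1, z₁.2 - z₂.2)‖)
    (hzs : (xs, us) ∈ Z) :
    ∃ D, 0 ≤ D ∧ ∀ H ∈ HSet h Z T, measH T (fun j => H j - h xs us) ≤ D := by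
  obtain ⟨D, hD, h1⟩ := h_bdd hZ hLh hhL hzs
  refine ⟨p * D, by positivity, fun H hH => measH_le (by positivity) fun k hk =>
    hatCol_le _ k hD fun i => ?_⟩
  have h2 := (hH k hk i).2
  have h3 : sSup ((fun z : Vec n × Vec m => h z.1 z.2 i) '' Z) ≤ h xs us i + D := by
    refine csSup_le (Set.Nonempty.image _ ⟨_, hzs⟩) ?_
    rintro _ ⟨y, hy, rfl⟩
    have := abs_le.1 (h1 y hy i)
    simp only; linarith
  simp only [PiLp.sub_apply]
  linarith

lemma kls_sum {β : ℝ → ℕ → ℝ} (hβ : KLS β) {r D : ℝ} (hr : 0 ≤ r) (hD : r ≤ D) (N : ℕ) :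
    ∑ k ∈ range N, β r k ≤ ∑' k, β D k := by
  obtain ⟨-, b2, b3, -, b5, -⟩ := hβ
  calc ∑ k ∈ range N, β r k ≤ ∑' k, β r k :=
        (b3 r hr).sum_le_tsum _ fun k _ => (b2 r hr).2.1 k
    _ ≤ _ := b5.monotoneOn hr (hr.trans hD) hD

/-- Distance to the steady state along a trajectory. -/
def ee (f : Vec n → Vec m → Vec n) (xs : Vec n) (us : Vec m) (x : Vec n) (u : ℕ → Vec m)
    (k : ℕ) : ℝ := ‖(traj f x u k - xs, u k - us)‖

lemma ee_le {x : Vec n} {u : ℕ → Vec m} {k : ℕ} {c : ℝ} :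
    ee f xs us x u k ≤ c ↔ ‖traj f x u k - xs‖ ≤ c ∧ ‖u k - us‖ ≤ c := by
  simp [ee, Prod.norm_def]

lemma ee_nonneg {x : Vec n} {u : ℕ → Vec m} {k : ℕ} : 0 ≤ ee f xs us x u k := norm_nonneg _

lemma join {Eh δc : ℝ} {d : ℕ} {γx γu : ℝ → ℝ} (hT : 1 ≤ T)
    (hLh : 0 < Lh) (hhL : ∀ z₁ ∈ Z, ∀ z₂ ∈ Z,
      ‖h z₁.1 z₁.2 - h z₂.1 z₂.2‖ ≤ Lh * ‖(z₁.1 - z₂.1, z₁.2 - z₂.2)‖)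
    (hzs : (xs, us) ∈ Z) (hfix : f xs us = xs) (hhs : ∀ i, h xs us i ≤ 0)
    (hδc : 0 < δc) (hEh : 0 < Eh) (hγx : KInf γx) (hγu : KInf γu)
    (hloc : LocCtrl f h Z T xs δc Eh d γx γu) {η : ℝ} (hη : 0 < η) :
    ∃ δ > 0, ∀ x₂ (H₂ : ℕ → Vec p), ‖x₂ - xs‖ ≤ δ →
      (∀ k ∈ Icc 1 (T - 1), ‖H₂ k - h xs us‖ ≤ Lh * δ) →
      ∀ N₁ x₁ H₁ u₁, d + T ≤ N₁ → x₁ ∈ Prod.fst '' Z → H₁ ∈ HSet h Z T →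
        Admissible f h Z T N₁ x₁ H₁ u₁ → (∀ k < d + T, ee f xs us x₁ u₁ k ≤ δ) →
        ∃ w, Admissible f h Z T N₁ x₂ H₂ w ∧ traj f x₂ w d = traj f x₁ u₁ d ∧
          (∀ k, d ≤ k → w k = u₁ k) ∧
          (∀ k ≤ d, ‖traj f x₂ w k - xs‖ ≤ η) ∧ (∀ k < d, ‖w k - us‖ ≤ η) := by
  obtain ⟨δ₁, hδ₁, g1⟩ := kinf_small hγx hη
  obtain ⟨δ₂, hδ₂, g2⟩ := kinf_small hγu hη
  have hc : 0 < 1 + p * Lh := by positivity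
  set μ := min (min δ₁ δ₂) (min δc Eh) with hμ
  have hμ0 : 0 < μ := by positivity
  have hμ1 : μ ≤ δ₁ := (min_le_left _ _).trans (min_le_left _ _)
  have hμ2 : μ ≤ δ₂ := (min_le_left _ _).trans (min_le_right _ _)
  have hμ3 : μ ≤ δc := (min_le_right _ _).trans (min_le_left _ _)
  have hμ4 : μ ≤ Eh := (min_le_right _ _).trans (min_le_right _ _)
  set δ := μ / (1 + p * Lh) with hδ
  have hδ0 : 0 < δ := by positivity
  have hδμ : δ + p * (Lh * δ) = μ := by rw [hδ]; field_simp
  have hpl : 0 ≤ p * (Lh * δ) := by positivity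
  refine ⟨δ, hδ0, fun x₂ H₂ hx₂ hH₂ N₁ x₁ H₁ u₁ hN hx₁ hH₁ ha hn => ?_⟩
  have hsm : measH T (fun k => storedH f h x₁ u₁ d k -
      storedH f h xs (fun _ => us) d k) ≤ p * (Lh * δ) := by
    apply measH_le_norm (by positivity)
    intro k hk
    rw [Finset.mem_Icc] at hk
    simp only [storedH, traj_const hfix]
    have hz := ha.1 (d + k - 1) (by omega)
    refine (hhL _ hz _ hzs).trans ?_
    have := hn (d + k - 1) (by omega)
    unfold ee at this
    gcongr
  have hH₂m : measH T (fun k => H₂ k - h xs us) ≤ p * (Lh * δ) :=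
    measH_le_norm (by positivity) hH₂
  have hd := (ee_le.1 (hn d (by omega))).1
  obtain ⟨u₂, c1, c2, c3, c4⟩ := hloc xs (fun _ => h xs us) (fun _ => us)
    (adm_const hzs hfix hhs _)
    (measH_le hEh.le fun k _ => by
      simp only [hatCol, max_eq_right (hhs _)]; simpa using hEh.le)
    (fun k _ => by rw [traj_const hfix]; simpa using hδc.le)
    N₁ x₁ H₁ u₁ hN hx₁ hH₁ ha (by linarith) (by linarith) x₂ H₂ (by linarith) (by linarith)
  have htr : ∀ k ≤ d, traj f x₂ (fun k => if k < d then u₂ k else u₁ k) k = traj f x₂ u₂ k := by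
    intro k hk
    apply traj_congr
    intro j hj
    simp [show j < d by omega]
  simp only [traj_const hfix] at c4 hsm
  have hmax : max (‖x₂ - xs‖ + measH T (fun j => H₂ j - h xs us))
      (‖traj f x₁ u₁ d - xs‖ + measH T (fun j => storedH f h x₁ u₁ d j -
        storedH f h xs (fun _ => us) d j)) ≤ μ := max_le (by linarith) (by linarith)
  have hmax0 : 0 ≤ max (‖x₂ - xs‖ + measH T (fun j => H₂ j - h xs us))
      (‖traj f x₁ u₁ d - xs‖ + measH T (fun j => storedH f h x₁ u₁ d j -
        storedH f h xs (fun _ => us) d j)) :=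
    le_max_of_le_left (add_nonneg (norm_nonneg _) (measH_nonneg _))
  refine ⟨_, c3, ?_, ?_, ?_, ?_⟩
  · rw [htr d le_rfl, c2]
  · intro k hk; simp [show ¬ k < d by omega]
  · intro k hk
    rw [htr k hk]
    exact (c4 k hk).1.trans (g1 _ hmax0 (hmax.trans hμ1))
  · intro k hk
    simp only [hk, if_true]
    exact (c4 k hk.le).2.trans (g2 _ hmax0 (hmax.trans hμ2))

lemma near_small {lam : Vec n → ℝ} {lb : Vec p} 
    (halc : ∃ αl : ℝ → ℝ, KInf αl ∧ ∀ z₁ ∈ Z, ∀ z₂ ∈ Z,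
      |ℓ z₁.1 z₁.2 - ℓ z₂.1 z₂.2| ≤ αl ‖(z₁.1 - z₂.1, z₁.2 - z₂.2)‖)
    (hLh : 0 < Lh)
    (hhL : ∀ z₁ ∈ Z, ∀ z₂ ∈ Z,
      ‖h z₁.1 z₁.2 - h z₂.1 z₂.2‖ ≤ Lh * ‖(z₁.1 - z₂.1, z₁.2 - z₂.2)‖)
    (hzs : (xs, us) ∈ Z) (hhs : ∀ i, h xs us i ≤ 0)
    (hlb : ∀ i, 0 ≤ lb i) (hlam0 : lam xs = 0)
    (hlamc : ∃ αlam : ℝ → ℝ, KInf αlam ∧ ∀ x₁ ∈ Prod.fst '' Z, ∀ x₂ ∈ Prod.fst '' Z,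
      |lam x₁ - lam x₂| ≤ αlam ‖x₁ - x₂‖) {ν : ℝ} (hν : 0 < ν) :
    ∃ δ > 0, (∀ z ∈ Z, ‖(z.1 - xs, z.2 - us)‖ ≤ δ → |ℓ z.1 z.2 - ℓ xs us| ≤ ν ∧
        ∑ i, lb i * h z.1 z.2 i ≤ ν) ∧
      (∀ x ∈ Prod.fst '' Z, ‖x - xs‖ ≤ δ → |lam x| ≤ ν) := by
  obtain ⟨αl, kl, hl⟩ := halc
  obtain ⟨αm, km, hm⟩ := hlamc
  obtain ⟨δ₁, hδ₁, g1⟩ := kinf_small kl hν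
  obtain ⟨δ₂, hδ₂, g2⟩ := kinf_small km hν
  set S := ∑ i, lb i with hS
  have hS0 : 0 ≤ S := Finset.sum_nonneg fun i _ => hlb i
  set δ₃ := ν / (S * Lh + 1) with hδ₃
  have hδ₃0 : 0 < δ₃ := by positivity
  have h3 : S * (Lh * δ₃) ≤ ν := by
    rw [hδ₃, ← mul_assoc, ← mul_div_assoc, div_le_iff₀ (by positivity)]
    nlinarith
  refine ⟨min (min δ₁ δ₂) δ₃, by positivity, fun z hz hzd => ⟨?_, ?_⟩, fun x hx hxd => ?_⟩
  · exact (hl z hz _ hzs).trans (g1 _ (norm_nonneg _)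
      (hzd.trans ((min_le_left _ _).trans (min_le_left _ _))))
  · have hz3 : ‖(z.1 - xs, z.2 - us)‖ ≤ δ₃ := hzd.trans (min_le_right _ _)
    calc ∑ i, lb i * h z.1 z.2 i ≤ ∑ i, lb i * (Lh * δ₃) := by
          apply Finset.sum_le_sum
          intro i _
          apply mul_le_mul_of_nonneg_left _ (hlb i)
          have h4 := (abs_le.1 (h_coord hhL hzs hz i)).2
          have h5 : Lh * ‖(z.1 - xs, z.2 - us)‖ ≤ Lh * δ₃ := by gcongr
          have := hhs i
          linarith
      _ = S * (Lh * δ₃) := by rw [hS, Finset.sum_mul]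
      _ ≤ ν := h3
  · have := hm x hx xs ⟨_, hzs, rfl⟩
    rw [hlam0, sub_zero] at this
    exact this.trans (g2 _ (norm_nonneg _)
      (hxd.trans ((min_le_left _ _).trans (min_le_right _ _))))

lemma sum_diff (G : Vec n → Vec m → ℝ) {x₁ x₂ : Vec n} {u₁ w : ℕ → Vec m} {d N₁ : ℕ} {c : ℝ}
    (hN : d ≤ N₁) (htr : traj f x₂ w d = traj f x₁ u₁ d) (hw : ∀ k, d ≤ k → w k = u₁ k)
    (hG : ∀ k < d, G (traj f x₂ w k) (w k) ≤ G (traj f x₁ u₁ k) (u₁ k) + c) :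
    ∑ k ∈ range N₁, G (traj f x₂ w k) (w k) ≤
      ∑ k ∈ range N₁, G (traj f x₁ u₁ k) (u₁ k) + d * c := by
  obtain ⟨r, rfl⟩ := Nat.exists_eq_add_of_le hN
  rw [sum_shift, sum_shift G x₁]
  have e : (fun j => w (d + j)) = fun j => u₁ (d + j) := funext fun j => hw _ (by omega)
  have e' : ∀ j, w (d + j) = u₁ (d + j) := fun j => hw _ (by omega)
  simp only [e', htr]
  have : ∑ k ∈ range d, G (traj f x₂ w k) (w k) ≤
      ∑ k ∈ range d, (G (traj f x₁ u₁ k) (u₁ k) + c) :=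
    Finset.sum_le_sum fun k hk => hG k (Finset.mem_range.1 hk)
  rw [Finset.sum_add_distrib] at this
  simp only [Finset.sum_const, Finset.card_range, nsmul_eq_mul] at this
  linarith

/-- Joining property with cost estimates. -/
def JC (f : Vec n → Vec m → Vec n) (ℓ : Vec n → Vec m → ℝ)
    (h : Vec n → Vec m → Vec p) (Z : Set (Vec n × Vec m)) (T : ℕ) (Lh : ℝ)
    (xs : Vec n) (us : Vec m) (lam : Vec n → ℝ) (lb : Vec p) (d : ℕ) : Prop :=
  ∀ η : ℝ, 0 < η → ∃ δ > 0, ∀ x₂ (H₂ : ℕ → Vec p), ‖x₂ - xs‖ ≤ δ →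
      (∀ k ∈ Icc 1 (T - 1), ‖H₂ k - h xs us‖ ≤ Lh * δ) →
      ∀ N₁ x₁ H₁ u₁, d + T ≤ N₁ → x₁ ∈ Prod.fst '' Z → H₁ ∈ HSet h Z T →
        Admissible f h Z T N₁ x₁ H₁ u₁ → (∀ k < d + T, ee f xs us x₁ u₁ k ≤ δ) →
        ∃ w, Admissible f h Z T N₁ x₂ H₂ w ∧ cost f ℓ x₂ w N₁ ≤ cost f ℓ x₁ u₁ N₁ + η ∧
          rcost f ℓ h (ℓ xs us) lam lb x₂ w N₁ ≤ rcost f ℓ h (ℓ xs us) lam lb x₁ u₁ N₁ + η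

lemma join_cost {Eh δc : ℝ} {d : ℕ} {γx γu ρ : ℝ → ℝ} {lam : Vec n → ℝ} {lb : Vec p} (hT : 1 ≤ T)
    (halc : ∃ αl : ℝ → ℝ, KInf αl ∧ ∀ z₁ ∈ Z, ∀ z₂ ∈ Z,
      |ℓ z₁.1 z₁.2 - ℓ z₂.1 z₂.2| ≤ αl ‖(z₁.1 - z₂.1, z₁.2 - z₂.2)‖)
    (hLh : 0 < Lh)
    (hhL : ∀ z₁ ∈ Z, ∀ z₂ ∈ Z,
      ‖h z₁.1 z₁.2 - h z₂.1 z₂.2‖ ≤ Lh * ‖(z₁.1 - z₂.1, z₁.2 - z₂.2)‖)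
    (hzs : (xs, us) ∈ Z) (hfix : f xs us = xs) (hhs : ∀ i, h xs us i ≤ 0)
    (hρ : KInf ρ) (hlb : ∀ i, 0 ≤ lb i) (hlam0 : lam xs = 0)
    (hlamc : ∃ αlam : ℝ → ℝ, KInf αlam ∧ ∀ x₁ ∈ Prod.fst '' Z, ∀ x₂ ∈ Prod.fst '' Z,
      |lam x₁ - lam x₂| ≤ αlam ‖x₁ - x₂‖)
    (hrot : ∀ z ∈ Z, ρ ‖(z.1 - xs, z.2 - us)‖ ≤ rot f ℓ h (ℓ xs us) lam lb z.1 z.2)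
    (hδc : 0 < δc) (hEh : 0 < Eh) (hγx : KInf γx) (hγu : KInf γu)
    (hloc : LocCtrl f h Z T xs δc Eh d γx γu) : JC f ℓ h Z T Lh xs us lam lb d := by
  intro η hη
  set ν := η / (4 * (d + 1)) with hν
  have hν0 : 0 < ν := by positivity
  have hνη : d * (4 * ν) ≤ η := by
    rw [hν, ← mul_assoc, ← mul_div_assoc, div_le_iff₀ (by positivity)]
    nlinarith
  obtain ⟨δ₁, hδ₁, n1, n2⟩ := near_small halc hLh hhL hzs hhs hlb hlam0 hlamc hν0
  obtain ⟨δ₂, hδ₂, j1⟩ := join hT hLh hhL hzs hfix hhs hδc hEh hγx hγu hloc hδ₁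
  refine ⟨min δ₁ δ₂, by positivity, fun x₂ H₂ hx₂ hH₂ N₁ x₁ H₁ u₁ hN hx₁ hH₁ ha hn => ?_⟩
  obtain ⟨w, w1, w2, w3, w4, w5⟩ := j1 x₂ H₂ (hx₂.trans (min_le_right _ _))
    (fun k hk => (hH₂ k hk).trans (mul_le_mul_of_nonneg_left (min_le_right _ _) hLh.le))
    N₁ x₁ H₁ u₁ hN hx₁ hH₁ ha (fun k hk => (hn k hk).trans (min_le_right _ _))
  have hew : ∀ k < d, ‖(traj f x₂ w k - xs, w k - us)‖ ≤ δ₁ := fun k hk =>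
    ee_le.2 ⟨w4 k hk.le, w5 k hk⟩
  have heu : ∀ k < d, ‖(traj f x₁ u₁ k - xs, u₁ k - us)‖ ≤ δ₁ := fun k hk =>
    (hn k (by omega)).trans (min_le_left _ _)
  refine ⟨w, w1, ?_, ?_⟩
  · refine (sum_diff ℓ (c := 4 * ν) (by omega) w2 w3 fun k hk => ?_).trans (by
      unfold cost; linarith)
    have a := abs_le.1 (n1 _ (w1.1 k (by omega)) (hew k hk)).1
    have b := abs_le.1 (n1 _ (ha.1 k (by omega)) (heu k hk)).1
    simp only at a b
    linarith [a.2, b.1]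
  · refine (sum_diff (rot f ℓ h (ℓ xs us) lam lb) (c := 4 * ν) (by omega) w2 w3
      fun k hk => ?_).trans (by unfold rcost; linarith)
    have a := n1 _ (w1.1 k (by omega)) (hew k hk)
    have b := (kinf_nonneg hρ (norm_nonneg _)).trans (hrot _ (ha.1 k (by omega)))
    have c := n2 (traj f x₂ w k) ⟨_, w1.1 k (by omega), rfl⟩ (w4 k hk.le)
    have e := n2 (traj f x₂ w (k + 1)) ⟨_, w1.1 (k + 1) (by omega), rfl⟩ (w4 (k + 1) hk)
    have a1 := (abs_le.1 a.1).2
    have a2 := a.2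
    have c1 := (abs_le.1 c).2
    have e1 := (abs_le.1 e).1
    simp only [traj] at a1 a2 b c1 e1
    have : rot f ℓ h (ℓ xs us) lam lb (traj f x₂ w k) (w k) ≤ 4 * ν := by
      unfold rot; linarith
    linarith

lemma hist_mem (hZ : IsCompact Z) (hLh : 0 < Lh) (hhL : ∀ z₁ ∈ Z, ∀ z₂ ∈ Z,
      ‖h z₁.1 z₁.2 - h z₂.1 z₂.2‖ ≤ Lh * ‖(z₁.1 - z₂.1, z₁.2 - z₂.2)‖)
    (hzs : (xs, us) ∈ Z) {x : Vec n} {H : ℕ → Vec p} {u : ℕ → Vec m} {N k : ℕ}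
    (ha : Admissible f h Z T N x H u) (hk : k ≤ N) (hT : 1 ≤ T) (hkT : T - 1 ≤ k) :
    hist f h T x u k ∈ HSet h Z T := by
  apply mem_HSet hZ hLh hhL hzs
  intro l hl
  rw [Finset.mem_Icc] at hl
  exact ⟨_, ha.1 (k + l - T) (by omega), rfl⟩

/-- Splicing property: follow `u` until `k`, then join `u₁`. -/
def SP (f : Vec n → Vec m → Vec n) (ℓ : Vec n → Vec m → ℝ)
    (h : Vec n → Vec m → Vec p) (Z : Set (Vec n × Vec m)) (T : ℕ)
    (xs : Vec n) (us : Vec m) (lam : Vec n → ℝ) (lb : Vec p) (d : ℕ) (δ η : ℝ) : Prop :=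
  ∀ N₁ k x H u x₁ H₁ u₁, d + T ≤ N₁ → T - 1 ≤ k → Admissible f h Z T (k + N₁) x H u →
    (∀ j ∈ Icc (k + 1 - T) k, ee f xs us x u j ≤ δ) →
    x₁ ∈ Prod.fst '' Z → H₁ ∈ HSet h Z T →
    Admissible f h Z T N₁ x₁ H₁ u₁ → (∀ k < d + T, ee f xs us x₁ u₁ k ≤ δ) →
    ∃ w, Admissible f h Z T (k + N₁) x H w ∧
      cost f ℓ x w (k + N₁) ≤ cost f ℓ x u k + cost f ℓ x₁ u₁ N₁ + η ∧
      rcost f ℓ h (ℓ xs us) lam lb x w (k + N₁) ≤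
        rcost f ℓ h (ℓ xs us) lam lb x u k + rcost f ℓ h (ℓ xs us) lam lb x₁ u₁ N₁ + η

lemma splice {d : ℕ} {lam : Vec n → ℝ} {lb : Vec p} (hT : 1 ≤ T)
    (hLh : 0 < Lh)
    (hhL : ∀ z₁ ∈ Z, ∀ z₂ ∈ Z,
      ‖h z₁.1 z₁.2 - h z₂.1 z₂.2‖ ≤ Lh * ‖(z₁.1 - z₂.1, z₁.2 - z₂.2)‖)
    (hzs : (xs, us) ∈ Z) (hJ : JC f ℓ h Z T Lh xs us lam lb d) {η : ℝ} (hη : 0 < η) :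
    ∃ δ > 0, SP f ℓ h Z T xs us lam lb d δ η := by
  obtain ⟨δ, hδ, j1⟩ := hJ η hη
  refine ⟨δ, hδ, fun N₁ k x H u x₁ H₁ u₁ hN hk ha hn hx₁ hH₁ ha₁ hn₁ => ?_⟩
  obtain ⟨w, w1, w2, w3⟩ := j1 (traj f x u k) (hist f h T x u k)
    (ee_le.1 (hn k (Finset.mem_Icc.2 ⟨by omega, le_rfl⟩))).1
    (fun l hl => by
      rw [Finset.mem_Icc] at hl
      refine (hhL _ (ha.1 (k + l - T) (by omega)) _ hzs).trans ?_
      have := hn (k + l - T) (Finset.mem_Icc.2 ⟨by omega, by omega⟩)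
      unfold ee at this
      gcongr) N₁ x₁ H₁ u₁ hN hx₁ hH₁ ha₁ hn₁
  refine ⟨conc k u w, adm_conc ha hk w1, ?_, ?_⟩
  · have := sum_conc (f := f) ℓ x u w k N₁
    unfold cost at *
    linarith
  · have := sum_conc (f := f) (rot f ℓ h (ℓ xs us) lam lb) x u w k N₁
    unfold rcost at *
    linarith

lemma rcost_eq {lam : Vec n → ℝ} {lb : Vec p} {ℓs : ℝ} (x : Vec n) (u : ℕ → Vec m) (k : ℕ) :
    rcost f ℓ h ℓs lam lb x u k = cost f ℓ x u k - k * ℓs + lam x - lam (traj f x u k) +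
      ∑ j ∈ range k, ∑ i, lb i * h (traj f x u j) (u j) i := by
  induction k with
  | zero => simp [rcost, cost, traj]
  | succ k ih =>
    unfold rcost cost at *
    rw [Finset.sum_range_succ, ih, Finset.sum_range_succ, Finset.sum_range_succ]
    simp only [rot, traj]
    push_cast
    ring

lemma hsum_nonpos {lb : Vec p} (hlb : ∀ i, 0 ≤ lb i) {N : ℕ} {x : Vec n} {H : ℕ → Vec p}
    {u : ℕ → Vec m} (ha : Admissible f h Z T N x H u) (q : ℕ) (hq : q * T ≤ N) :
    ∑ j ∈ range (q * T), ∑ i, lb i * h (traj f x u j) (u j) i ≤ 0 := by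
  induction q with
  | zero => simp
  | succ q ih =>
    have e : (q + 1) * T = q * T + T := by ring
    rw [e] at hq ⊢
    have h1 := ih (by omega)
    rw [← Finset.sum_range_add_sum_Ico _ (by omega : q * T ≤ q * T + T), Finset.sum_comm (s := Ico _ _)]
    have h2 : ∑ i, ∑ j ∈ Ico (q * T) (q * T + T), lb i * h (traj f x u j) (u j) i ≤ 0 := by
      apply Finset.sum_nonpos
      intro i _
      rw [← Finset.mul_sum]
      exact mul_nonpos_of_nonneg_of_nonpos (hlb i) (ha.2.2 _ hq i)
    linarith

lemma Jstar_le {Dl ℓs : ℝ} (hDl : ∀ z ∈ Z, |ℓ z.1 z.2 - ℓs| ≤ Dl) {N : ℕ} {x : Vec n}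
    {H : ℕ → Vec p} {u : ℕ → Vec m} (ha : Admissible f h Z T N x H u) :
    Jstar f ℓ h Z T N x H ≤ cost f ℓ x u N := by
  refine csInf_le ?_ (Set.mem_image_of_mem _ ha)
  refine ⟨∑ k ∈ range N, (ℓs - Dl), ?_⟩
  rintro _ ⟨v, hv, rfl⟩
  apply Finset.sum_le_sum
  intro k hk
  have := (abs_le.1 (hDl _ (hv.1 k (Finset.mem_range.1 hk)))).1
  simp only at this
  linarith

lemma Jtstar_le {lam : Vec n → ℝ} {lb : Vec p} {ℓs : ℝ}
    (hrot : ∀ z ∈ Z, 0 ≤ rot f ℓ h ℓs lam lb z.1 z.2) {N : ℕ} {x : Vec n}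
    {H : ℕ → Vec p} {u : ℕ → Vec m} (ha : Admissible f h Z T N x H u) :
    Jtstar f ℓ h Z T ℓs lam lb N x H ≤ rcost f ℓ h ℓs lam lb x u N := by
  refine csInf_le ?_ (Set.mem_image_of_mem _ ha)
  refine ⟨0, ?_⟩
  rintro _ ⟨v, hv, rfl⟩
  apply Finset.sum_nonneg
  intro k hk
  exact hrot _ (hv.1 k (Finset.mem_range.1 hk))

lemma avg {g : ℕ → ℝ} (hg : ∀ k, 0 ≤ g k) {B Q q : ℕ} {C c : ℝ}
    (hsum : ∑ k ∈ range (Q * B), g k ≤ C) (hq : q + 1 ≤ Q) (hC : C < q * c) :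
    ∃ j, 1 ≤ j ∧ j ≤ q ∧ ∀ k, j * B ≤ k → k < (j + 1) * B → g k < c := by
  by_contra! hcon
  have key : ∀ j ≤ q, j * c ≤ ∑ k ∈ range ((j + 1) * B), g k := by
    intro j
    induction j with
    | zero =>
      intro _
      simpa using Finset.sum_nonneg fun k _ => hg k
    | succ j ih =>
      intro hj
      have h1 := ih (by omega)
      obtain ⟨k, k1, k2, k3⟩ := hcon (j + 1) (by omega) hj
      have e : (j + 1) * B ≤ (j + 1 + 1) * B := Nat.mul_le_mul_right _ (by omega)
      rw [← Finset.sum_range_add_sum_Ico _ e]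
      have h2 : g k ≤ ∑ i ∈ Ico ((j + 1) * B) ((j + 1 + 1) * B), g i :=
        Finset.single_le_sum (f := g) (fun i _ => hg i) (Finset.mem_Ico.2 ⟨k1, k2⟩)
      push_cast
      linarith
  have h1 := key q le_rfl
  have h2 : ∑ k ∈ range ((q + 1) * B), g k ≤ ∑ k ∈ range (Q * B), g k :=
    Finset.sum_le_sum_of_subset_of_nonneg
      (Finset.range_subset_range.2 (Nat.mul_le_mul_right _ hq)) fun i _ _ => hg i
  linarith

lemma window {g : ℕ → ℝ} (hg : ∀ k, 0 ≤ g k) {T d Q q : ℕ} {C c : ℝ} (hT : 1 ≤ T)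
    (hsum : ∑ k ∈ range (Q * (T * (2 * (d + T)))), g k ≤ C) (hq : q + 1 ≤ Q) (hC : C < q * c) :
    ∃ s, d + T ≤ s * T ∧ s * T + (d + T) ≤ (q + 1) * (T * (2 * (d + T))) ∧
      ∀ k, s * T ≤ k + T → k < s * T + (d + T) → g k < c := by
  obtain ⟨j, j1, j2, j3⟩ := avg hg hsum hq hC
  set B := T * (2 * (d + T)) with hB
  have hB1 : 2 * (d + T) ≤ B := Nat.le_mul_of_pos_left _ (by omega)
  have e : (j * (2 * (d + T)) + 1) * T = j * B + T := by rw [hB]; ring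
  have h1 : 1 * B ≤ j * B := Nat.mul_le_mul_right _ j1
  have h2 : (j + 1) * B ≤ (q + 1) * B := Nat.mul_le_mul_right _ (by omega)
  have h3 : (j + 1) * B = j * B + B := by ring
  refine ⟨j * (2 * (d + T)) + 1, ?_, ?_, ?_⟩
  · rw [e]; omega
  · rw [e]; omega
  · intro k hk1 hk2
    rw [e] at hk1 hk2
    exact j3 k (by omega) (by omega)

lemma rho_le {ρ : ℝ → ℝ} {lam : Vec n → ℝ} {lb : Vec p} {ℓs : ℝ}
    (hrot : ∀ z ∈ Z, ρ ‖(z.1 - xs, z.2 - us)‖ ≤ rot f ℓ h ℓs lam lb z.1 z.2)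
    {N K : ℕ} {x : Vec n} {H : ℕ → Vec p} {u : ℕ → Vec m}
    (ha : Admissible f h Z T N x H u) (hK : K ≤ N) :
    ∑ k ∈ range K, ρ (ee f xs us x u k) ≤ rcost f ℓ h ℓs lam lb x u K := by
  unfold rcost ee
  refine Finset.sum_le_sum fun k hk => ?_
  have hk' := Finset.mem_range.1 hk
  exact hrot (traj f x u k, u k) (ha.1 k (lt_of_lt_of_le hk' hK))

lemma stepA {d : ℕ} {lam : Vec n → ℝ} {lb : Vec p} {ρ : ℝ → ℝ} (hT : 1 ≤ T)
    (hZ : IsCompact Z) (hLh : 0 < Lh)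
    (hhL : ∀ z₁ ∈ Z, ∀ z₂ ∈ Z,
      ‖h z₁.1 z₁.2 - h z₂.1 z₂.2‖ ≤ Lh * ‖(z₁.1 - z₂.1, z₁.2 - z₂.2)‖)
    (hzs : (xs, us) ∈ Z) (hfix : f xs us = xs) (hhs : ∀ i, h xs us i ≤ 0)
    (hlb : ∀ i, 0 ≤ lb i) (hlam0 : lam xs = 0)
    (hrot : ∀ z ∈ Z, ρ ‖(z.1 - xs, z.2 - us)‖ ≤ rot f ℓ h (ℓ xs us) lam lb z.1 z.2)
    {δ η : ℝ} (hδ : 0 ≤ δ) (hSP : SP f ℓ h Z T xs us lam lb d δ η)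
    (hlam : ∀ x ∈ Prod.fst '' Z, ‖x - xs‖ ≤ δ → |lam x| ≤ η)
    {s M : ℕ} {v : ℕ → Vec m} (hv : Admissible f h Z T (s * T + M) xs (fun _ => h xs us) v)
    (hopt : ∀ w, Admissible f h Z T (s * T + M) xs (fun _ => h xs us) w →
      cost f ℓ xs v (s * T + M) ≤ cost f ℓ xs w (s * T + M))
    (hM : d + T ≤ M) (hs : T ≤ s * T)
    (hn : ∀ k, s * T ≤ k → k < s * T + (d + T) → ee f xs us xs v k ≤ δ) :
    ∑ k ∈ range (s * T), ρ (ee f xs us xs v k) ≤ 2 * η := by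
  have hX : traj f xs v (s * T) ∈ Prod.fst '' Z := ⟨_, hv.1 (s * T) (by omega), rfl⟩
  obtain ⟨w, w1, w2, -⟩ := hSP M (s * T) xs (fun _ => h xs us) (fun _ => us)
    (traj f xs v (s * T)) (hist f h T xs v (s * T)) (fun j => v (s * T + j)) hM (by omega)
    (adm_const hzs hfix hhs _)
    (fun j _ => ee_le.2 ⟨by rw [traj_const hfix]; simpa using hδ, by simpa using hδ⟩)
    hX (hist_mem hZ hLh hhL hzs hv (by omega) hT (by omega))
    (adm_tail hv (by omega) (by omega))
    (fun k hk => by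
      have := hn (s * T + k) (by omega) (by omega)
      rw [ee] at this ⊢
      rwa [traj_shift])
  have h1 := hopt w w1
  have h2 := sum_shift (f := f) ℓ xs v (s * T) M
  have h3 : cost f ℓ xs (fun _ => us) (s * T) = (s * T : ℕ) * ℓ xs us := by
    simp [cost, traj_const hfix]
  have h4 := rho_le hrot hv (K := s * T) (by omega)
  have h5 := hsum_nonpos hlb hv s (by omega)
  rw [rcost_eq, hlam0] at h4
  have h6 := (abs_le.1 (hlam _ hX (ee_le.1 (hn _ le_rfl (by omega))).1)).1
  have h7 : cost f ℓ xs v (s * T + M) = cost f ℓ xs v (s * T) +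
    cost f ℓ (traj f xs v (s * T)) (fun j => v (s * T + j)) M := h2
  linarith

lemma SP.mono {d : ℕ} {lam : Vec n → ℝ} {lb : Vec p} {δ δ' η : ℝ}
    (hSP : SP f ℓ h Z T xs us lam lb d δ η) (hδ : δ' ≤ δ) :
    SP f ℓ h Z T xs us lam lb d δ' η :=
  fun N₁ k x H u x₁ H₁ u₁ a b c e g i j l => hSP N₁ k x H u x₁ H₁ u₁ a b c
    (fun r hr => (e r hr).trans hδ) g i j (fun r hr => (l r hr).trans hδ)

lemma exists_sigma (P : ℕ → ℝ → Prop) (hmono : ∀ N a b, a ≤ b → P N a → P N b)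
    (hP : ∀ η > 0, ∃ N₀, ∀ N ≥ N₀, P N η) (c : ℕ) :
    ∃ (σ : ℕ → ℝ) (N₅ : ℕ), LN σ ∧ ∀ N ≥ N₅, P N (σ (N - c)) := by
  obtain ⟨N₁, hN₁⟩ := hP 1 one_pos
  let S : ℕ → Set ℝ := fun M => insert 1 {η | 0 < η ∧ ∀ N ≥ M, P N η}
  have hne : ∀ M, (S M).Nonempty := fun M => ⟨1, Set.mem_insert _ _⟩
  have hpos : ∀ M, ∀ η ∈ S M, 0 ≤ η := by
    rintro M η (rfl | hη)
    · exact zero_le_one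
    · exact hη.1.le
  have hbdd : ∀ M, BddBelow (S M) := fun M => ⟨0, hpos M⟩
  have h0 : ∀ M, 0 ≤ sInf (S M) := fun M => le_csInf (hne M) (hpos M)
  have hanti : Antitone fun M => sInf (S M) := by
    intro a b hab
    apply csInf_le_csInf (hbdd b) (hne a)
    rintro η (rfl | hη)
    · exact Set.mem_insert _ _
    · exact Or.inr ⟨hη.1, fun N hN => hη.2 N (le_trans hab hN)⟩
  have hlim : Tendsto (fun M => sInf (S M)) atTop (nhds 0) := by
    rw [Metric.tendsto_atTop]
    intro ε hε
    obtain ⟨N₀, hN₀⟩ := hP (ε / 2) (by positivity)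
    refine ⟨N₀, fun M hM => ?_⟩
    rw [Real.dist_eq, sub_zero, abs_of_nonneg (h0 M)]
    have : sInf (S M) ≤ ε / 2 :=
      csInf_le (hbdd M) (Or.inr ⟨by positivity, fun N hN => hN₀ N (le_trans hM hN)⟩)
    linarith
  refine ⟨fun M => sInf (S M) + 1 / ((M : ℝ) + 1), N₁ + c, ⟨?_, ?_, ?_⟩, ?_⟩
  · intro a b hab
    have h1 := hanti hab
    have h2 : 1 / ((b : ℝ) + 1) ≤ 1 / ((a : ℝ) + 1) := Nat.one_div_le_one_div hab
    simp only at h1 ⊢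
    linarith
  · intro k
    have := h0 k
    positivity
  · simpa using hlim.add tendsto_one_div_add_atTop_nhds_zero_nat
  · intro N hN
    have hlt : sInf (S (N - c)) < sInf (S (N - c)) + 1 / (((N - c : ℕ) : ℝ) + 1) := by
      have : 0 < 1 / (((N - c : ℕ) : ℝ) + 1) := by positivity
      linarith
    obtain ⟨η, hη, hηlt⟩ := exists_lt_of_csInf_lt (hne _) hlt
    apply hmono N η _ hηlt.le
    rcases hη with rfl | hη
    · exact hN₁ N (by omega)
    · exact hη.2 N (by omega)

end

end helpers

theorem residuum_bounds (n m p T : ℕ) (hT : 1 ≤ T)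
    (f : Vec n → Vec m → Vec n) (ℓ : Vec n → Vec m → ℝ)
    (h : Vec n → Vec m → Vec p) (Z : Set (Vec n × Vec m)) (Lh : ℝ)
    (xs : Vec n) (us : Vec m) (lam : Vec n → ℝ) (lb : Vec p) (ρ : ℝ → ℝ)
    (δc Eh : ℝ) (d : ℕ) (γx γu : ℝ → ℝ) (ψb : ℝ → ℝ)
    (ustar tust : ℕ → Vec n → (ℕ → Vec p) → ℕ → Vec m)
    -- Assumption 1 (compactness and continuity)
    (hZ : IsCompact Z)
    (hfc : ∃ αf : ℝ → ℝ, KInf αf ∧ ∀ z₁ ∈ Z, ∀ z₂ ∈ Z,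
      ‖f z₁.1 z₁.2 - f z₂.1 z₂.2‖ ≤ αf ‖(z₁.1 - z₂.1, z₁.2 - z₂.2)‖)
    (halc : ∃ αl : ℝ → ℝ, KInf αl ∧ ∀ z₁ ∈ Z, ∀ z₂ ∈ Z,
      |ℓ z₁.1 z₁.2 - ℓ z₂.1 z₂.2| ≤ αl ‖(z₁.1 - z₂.1, z₁.2 - z₂.2)‖)
    (hLh : 0 < Lh)
    (hhL : ∀ z₁ ∈ Z, ∀ z₂ ∈ Z,
      ‖h z₁.1 z₁.2 - h z₂.1 z₂.2‖ ≤ Lh * ‖(z₁.1 - z₂.1, z₁.2 - z₂.2)‖)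
    -- optimal steady-state
    (hzs : (xs, us) ∈ Z) (hfix : f xs us = xs) (hhs : ∀ i, h xs us i ≤ 0)
    -- Assumption 2 (strict dissipativity)
    (hρ : KInf ρ) (hlb : ∀ i, 0 ≤ lb i) (hlam0 : lam xs = 0)
    (hlamc : ∃ αlam : ℝ → ℝ, KInf αlam ∧ ∀ x₁ ∈ Prod.fst '' Z, ∀ x₂ ∈ Prod.fst '' Z,
      |lam x₁ - lam x₂| ≤ αlam ‖x₁ - x₂‖)
    (hdiss : ∀ z ∈ Z, lam (f z.1 z.2) - lam z.1 ≤
      ℓ z.1 z.2 - ℓ xs us + (∑ i, lb i * h z.1 z.2 i) - ρ ‖(z.1 - xs, z.2 - us)‖)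
    -- Assumption 3 (asymptotic controllability)
    (hac : ∃ β₁ β₂ : ℝ → ℕ → ℝ, KLS β₁ ∧ KLS β₂ ∧
      ∀ x ∈ Prod.fst '' Z, ∀ H ∈ HSet h Z T, ∀ N : ℕ, ∃ u : ℕ → Vec m,
        Admissible f h Z T N x H u ∧ ∀ k < N,
          ℓ (traj f x u k) (u k) - ℓ xs us ≤
            β₁ ‖x - xs‖ k + β₂ (measH T (fun j => H j - h xs us)) k ∧
          rot f ℓ h (ℓ xs us) lam lb (traj f x u k) (u k) ≤
            β₁ ‖x - xs‖ k + β₂ (measH T (fun j => H j - h xs us)) k)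
    -- Assumption 4 (local controllability)
    (hδc : 0 < δc) (hEh : 0 < Eh) (hdT : T ≤ d) (hγx : KInf γx) (hγu : KInf γu)
    (hloc : LocCtrl f h Z T xs δc Eh d γx γu)
    -- Assumption 5
    (hψb : KInf ψb)
    (hψ : ∀ kψ : ℕ, T - 1 ≤ kψ → ∀ N : ℕ, ∀ x ∈ Prod.fst '' Z, ∀ H ∈ HSet h Z T,
      -(∑ k ∈ Finset.range (kψ + 1), ∑ i,
          lb i * h (traj f x (tust N x H) k) (tust N x H k) i)
        ≤ ψb (l1 (x - xs) + norm1H T (fun j => H j - h xs us)))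
    -- the value function is attained by the unique minimizer `ustar`
    (hopt : ∀ (N : ℕ), ∀ x ∈ Prod.fst '' Z, ∀ H ∈ HSet h Z T,
      Admissible f h Z T N x H (ustar N x H) ∧
      cost f ℓ x (ustar N x H) N = Jstar f ℓ h Z T N x H ∧
      ∀ u : ℕ → Vec m, Admissible f h Z T N x H u →
        cost f ℓ x u N = Jstar f ℓ h Z T N x H → ∀ k < N, u k = ustar N x H k)
    -- the rotated value function is attained by the unique minimizer `tust`
    (htopt : ∀ (N : ℕ), ∀ x ∈ Prod.fst '' Z, ∀ H ∈ HSet h Z T,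
      Admissible f h Z T N x H (tust N x H) ∧
      rcost f ℓ h (ℓ xs us) lam lb x (tust N x H) N =
        Jtstar f ℓ h Z T (ℓ xs us) lam lb N x H ∧
      ∀ u : ℕ → Vec m, Admissible f h Z T N x H u →
        rcost f ℓ h (ℓ xs us) lam lb x u N =
          Jtstar f ℓ h Z T (ℓ xs us) lam lb N x H → ∀ k < N, u k = tust N x H k)
    :
    ∃ (N₂ N₅ : ℕ) (R₁ R₂ : ℝ → ℝ) (σT : ℕ → ℝ),
      KInf R₁ ∧ KInf R₂ ∧ LN σT ∧
      ∀ x ∈ Prod.fst '' Z, ∀ H ∈ HSet h Z T, ∀ N : ℕ, N₅ ≤ N →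
        ∃ kx : ℕ, T - 1 ≤ kx ∧ kx ≤ N - N₂ ∧
          (∀ k ∈ Finset.Icc (kx + 1 - T) kx,
            ‖(traj f x (ustar N x H) k - xs, ustar N x H k - us)‖ ≤
              σT (N - N₂ - T * (2 * T - 1)) ∧
            ‖(traj f x (tust N x H) k - xs, tust N x H k - us)‖ ≤
              σT (N - N₂ - T * (2 * T - 1))) ∧
          |Jstar f ℓ h Z T N x H - cost f ℓ x (ustar N x H) kx -
              Jstar f ℓ h Z T (N - kx) xs (fun _ => h xs us)| ≤
            R₁ (σT (N - N₂ - T * (2 * T - 1))) ∧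
          cost f ℓ x (ustar N x H) kx -
              (rcost f ℓ h (ℓ xs us) lam lb x (tust N x H) kx +
                kx * ℓ xs us - lam x) ≤
            ψb (l1 (x - xs) + norm1H T (fun j => H j - h xs us)) +
              R₂ (σT (N - N₂ - T * (2 * T - 1))) ∧
          (rcost f ℓ h (ℓ xs us) lam lb x (tust N x H) kx +
              kx * ℓ xs us - lam x) - cost f ℓ x (ustar N x H) kx ≤
            ((T : ℝ) - 1) * ‖lb‖ * Lh * σT (N - N₂ - T * (2 * T - 1)) +
              R₂ (σT (N - N₂ - T * (2 * T - 1))) := by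

  have hrot : ∀ z ∈ Z, ρ ‖(z.1 - xs, z.2 - us)‖ ≤ rot f ℓ h (ℓ xs us) lam lb z.1 z.2 := by
    intro z hz
    have := hdiss z hz
    unfold rot
    linarith
  have hrot0 : ∀ z ∈ Z, 0 ≤ rot f ℓ h (ℓ xs us) lam lb z.1 z.2 := fun z hz =>
    (kinf_nonneg hρ (norm_nonneg _)).trans (hrot z hz)
  obtain ⟨D, hD0, hD⟩ := diamZ hZ xs us
  obtain ⟨Dl, hDl0, hDl⟩ : ∃ Dl, 0 ≤ Dl ∧ ∀ z ∈ Z, |ℓ z.1 z.2 - ℓ xs us| ≤ Dl := by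
    obtain ⟨α, k, hα⟩ := halc
    exact ⟨α D, kinf_nonneg k hD0, fun z hz =>
      (hα z hz _ hzs).trans (kinf_mono k (norm_nonneg _) (hD z hz))⟩
  have hDx : ∀ x ∈ Prod.fst '' Z, ‖x - xs‖ ≤ D := by
    rintro _ ⟨z, hz, rfl⟩
    exact (norm_fst_le (z.1 - xs, z.2 - us)).trans (hD z hz)
  obtain ⟨Λ, hΛ⟩ : ∃ Λ, ∀ x ∈ Prod.fst '' Z, |lam x| ≤ Λ := by
    obtain ⟨α, k, hα⟩ := hlamc
    refine ⟨α D, fun x hx => ?_⟩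
    have := hα x hx xs ⟨_, hzs, rfl⟩
    rw [hlam0, sub_zero] at this
    exact this.trans (kinf_mono k (norm_nonneg _) (hDx x hx))
  have hJC : JC f ℓ h Z T Lh xs us lam lb d :=
    join_cost hT halc hLh hhL hzs hfix hhs hρ hlb hlam0 hlamc hrot hδc hEh hγx hγu hloc
  have hSPex := fun {η : ℝ} (hη : 0 < η) => splice hT hLh hhL hzs hJC hη
  have hnear := fun {ν : ℝ} (hν : 0 < ν) =>
    near_small halc hLh hhL hzs hhs hlb hlam0 hlamc hν
  have hHs : (fun _ => h xs us) ∈ HSet h Z T :=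
    mem_HSet hZ hLh hhL hzs fun k _ => ⟨_, hzs, rfl⟩
  have hxsX : xs ∈ Prod.fst '' Z := ⟨_, hzs, rfl⟩
  -- optimality in inequality form
  have hoptle : ∀ N, ∀ x ∈ Prod.fst '' Z, ∀ H ∈ HSet h Z T, ∀ w,
      Admissible f h Z T N x H w → cost f ℓ x (ustar N x H) N ≤ cost f ℓ x w N := by
    intro N x hx H hH w hw
    rw [(hopt N x hx H hH).2.1]
    exact Jstar_le hDl hw
  have htoptle : ∀ N, ∀ x ∈ Prod.fst '' Z, ∀ H ∈ HSet h Z T, ∀ w,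
      Admissible f h Z T N x H w → rcost f ℓ h (ℓ xs us) lam lb x (tust N x H) N ≤
        rcost f ℓ h (ℓ xs us) lam lb x w N := by
    intro N x hx H hH w hw
    rw [(htopt N x hx H hH).2.1]
    exact Jtstar_le hrot0 hw
  -- uniform bounds
  obtain ⟨C₁, hC₁⟩ : ∃ C₁ : ℝ, ∀ x ∈ Prod.fst '' Z, ∀ H ∈ HSet h Z T, ∀ N : ℕ,
      cost f ℓ x (ustar N x H) N ≤ N * ℓ xs us + C₁ ∧
      rcost f ℓ h (ℓ xs us) lam lb x (tust N x H) N ≤ C₁ := by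
    obtain ⟨β₁, β₂, hβ₁, hβ₂, hb⟩ := hac
    obtain ⟨E, hE0, hE⟩ := measH_bdd (T := T) hZ hLh hhL hzs
    refine ⟨(∑' k, β₁ D k) + ∑' k, β₂ E k, fun x hx H hH N => ?_⟩
    obtain ⟨u, u1, u2⟩ := hb x hx H hH N
    have s1 := kls_sum hβ₁ (norm_nonneg _) (hDx x hx) N
    have s2 := kls_sum hβ₂ (measH_nonneg _) (hE H hH) N
    constructor
    · refine (hoptle N x hx H hH u u1).trans ?_
      have : cost f ℓ x u N ≤ ∑ k ∈ range N, (ℓ xs us + (β₁ ‖x - xs‖ k +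
          β₂ (measH T (fun j => H j - h xs us)) k)) := by
        unfold cost
        refine Finset.sum_le_sum fun k hk => ?_
        have := (u2 k (Finset.mem_range.1 hk)).1
        linarith
      simp only [Finset.sum_add_distrib, Finset.sum_const, Finset.card_range,
        nsmul_eq_mul] at this
      linarith
    · refine (htoptle N x hx H hH u u1).trans ?_
      have : rcost f ℓ h (ℓ xs us) lam lb x u N ≤ ∑ k ∈ range N, (β₁ ‖x - xs‖ k +
          β₂ (measH T (fun j => H j - h xs us)) k) := by
        unfold rcost
        exact Finset.sum_le_sum fun k hk => (u2 k (Finset.mem_range.1 hk)).2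
      simp only [Finset.sum_add_distrib] at this
      linarith
  set B := T * (2 * (d + T)) with hB
  have hB1 : 2 * (d + T) ≤ B := Nat.le_mul_of_pos_left _ (by omega)
  have hB0 : 0 < B := by omega
  obtain ⟨C, hC⟩ : ∃ C : ℝ, ∀ x ∈ Prod.fst '' Z, ∀ H ∈ HSet h Z T, ∀ N : ℕ, 1 ≤ N →
      ∑ k ∈ range ((N - 1) / B * B), ρ (ee f xs us x (ustar N x H) k) ≤ C ∧
      ∑ k ∈ range ((N - 1) / B * B), ρ (ee f xs us x (tust N x H) k) ≤ C := by
    refine ⟨max (C₁ + B * Dl + 2 * Λ) C₁, fun x hx H hH N hN => ?_⟩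
    have hle : (N - 1) / B * B ≤ N - 1 := Nat.div_mul_le_self _ _
    have hmod := Nat.div_add_mod (N - 1) B
    have hmlt := Nat.mod_lt (N - 1) hB0
    rw [Nat.mul_comm] at hmod
    have hex : ∃ s, (N - 1) / B * B = s * T :=
      ⟨(N - 1) / B * (2 * (d + T)), by rw [hB]; ring⟩
    generalize (N - 1) / B * B = K at *
    obtain ⟨s, hs⟩ := hex
    obtain ⟨M, hM⟩ : ∃ M, N = K + M := ⟨N - K, by omega⟩
    have hMB : M ≤ B := by omega
    obtain ⟨c1, c2⟩ := hC₁ x hx H hH N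
    have ha := (hopt N x hx H hH).1
    have hta := (htopt N x hx H hH).1
    constructor
    · refine (rho_le hrot ha (by omega)).trans (le_max_of_le_left ?_)
      generalize ustar N x H = u at *
      rw [rcost_eq]
      have e1 : ∑ j ∈ range K, ∑ i, lb i * h (traj f x u j) (u j) i ≤ 0 := by
        rw [hs]; exact hsum_nonpos hlb ha s (by omega)
      have e2 := (abs_le.1 (hΛ x hx)).2
      have e3 := (abs_le.1 (hΛ (traj f x u K) ⟨_, ha.1 K (by omega), rfl⟩)).1
      have e4 : cost f ℓ x u N = cost f ℓ x u K +
          ∑ j ∈ range M, ℓ (traj f x u (K + j)) (u (K + j)) := by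
        rw [hM]; unfold cost; rw [Finset.sum_range_add]
      have e5 : ∑ j ∈ range M, (ℓ xs us - Dl) ≤
          ∑ j ∈ range M, ℓ (traj f x u (K + j)) (u (K + j)) := by
        refine Finset.sum_le_sum fun j hj => ?_
        have hj' := Finset.mem_range.1 hj
        have := (abs_le.1 (hDl _ (ha.1 (K + j) (by omega)))).1
        simp only at this
        linarith
      simp only [Finset.sum_const, Finset.card_range, nsmul_eq_mul] at e5
      have e6 : (M : ℝ) * Dl ≤ B * Dl := by gcongr
      have e7 : (N : ℝ) = K + M := by rw [hM]; push_cast; ring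
      rw [e7] at c1
      nlinarith
    · refine le_trans ?_ (le_max_of_le_right c2)
      refine le_trans ?_ (rho_le hrot hta le_rfl)
      exact Finset.sum_le_sum_of_subset_of_nonneg (Finset.range_subset_range.2 (by omega))
        fun k _ _ => kinf_nonneg hρ ee_nonneg
  have hρlt : ∀ {a b : ℝ}, 0 ≤ a → 0 ≤ b → ρ a < ρ b → a < b := fun ha hb hab =>
    (hρ.2.1.lt_iff_lt ha hb).1 hab
  have key : ∀ η > 0, ∃ N₀ : ℕ, ∀ N ≥ N₀, ∀ x ∈ Prod.fst '' Z, ∀ H ∈ HSet h Z T,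
      ∃ kx : ℕ, T - 1 ≤ kx ∧ kx ≤ N ∧
        (∀ k ∈ Finset.Icc (kx + 1 - T) kx, ee f xs us x (ustar N x H) k ≤ η ∧
          ee f xs us x (tust N x H) k ≤ η) ∧
        |Jstar f ℓ h Z T N x H - cost f ℓ x (ustar N x H) kx -
              Jstar f ℓ h Z T (N - kx) xs (fun _ => h xs us)| ≤ η ∧
        cost f ℓ x (ustar N x H) kx -
              (rcost f ℓ h (ℓ xs us) lam lb x (tust N x H) kx +
                kx * ℓ xs us - lam x) ≤
            ψb (l1 (x - xs) + norm1H T (fun j => H j - h xs us)) + η ∧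
        (rcost f ℓ h (ℓ xs us) lam lb x (tust N x H) kx +
              kx * ℓ xs us - lam x) - cost f ℓ x (ustar N x H) kx ≤ η := by
    intro η hη
    have hη3 : 0 < η / 3 := by positivity
    obtain ⟨δa, hδa, -, na⟩ := hnear hη3
    obtain ⟨δ₁, hδ₁, sp1⟩ := hSPex hη3
    obtain ⟨δ₂, hδ₂, jc2⟩ := hJC _ hη3
    obtain ⟨δ₃, hδ₃, l1', l2, l3, l4⟩ : ∃ δ₃ > 0, δ₃ ≤ δa ∧ δ₃ ≤ δ₁ ∧ δ₃ ≤ δ₂ ∧ δ₃ ≤ η :=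
      ⟨min (min δa δ₁) (min δ₂ η), by positivity, by simp, by simp, by simp, by simp⟩
    have hr := kinf_pos hρ hδ₃
    have hr3 : 0 < ρ δ₃ / 3 := by positivity
    obtain ⟨δ₄, hδ₄, sp4⟩ := hSPex hr3
    obtain ⟨δ₅, hδ₅, -, n5⟩ := hnear hr3
    obtain ⟨δ, hδ, l5, l6, l7⟩ : ∃ δ > 0, δ ≤ δ₃ ∧ δ ≤ δ₄ ∧ δ ≤ δ₅ :=
      ⟨min δ₃ (min δ₄ δ₅), by positivity, by simp, by simp, by simp⟩
    have hρδ := kinf_pos hρ hδ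
    obtain ⟨q, hq⟩ := exists_nat_gt ((2 * max C 0) / ρ δ)
    rw [div_lt_iff₀ hρδ] at hq
    have hCq : C + C < q * ρ δ := by linarith [le_max_left C 0]
    have hCq' : C < q * ρ δ := by linarith [le_max_left C 0, le_max_right C 0]
    refine ⟨B * (2 * q + 2) + 1, fun N hN x hx H hH => ?_⟩
    have hBq : B * (2 * q + 2) = (q + 1) * B + (q + 1) * B := by ring
    obtain ⟨t1, t2⟩ := hC x hx H hH N (by omega)
    obtain ⟨s, s1, s2, s3⟩ := window (g := fun k => ρ (ee f xs us x (ustar N x H) k) +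
        ρ (ee f xs us x (tust N x H) k))
      (fun k => add_nonneg (kinf_nonneg hρ ee_nonneg) (kinf_nonneg hρ ee_nonneg)) hT
      (Q := (N - 1) / B) (d := d) (C := C + C) (c := ρ δ) (q := q)
      (by rw [Finset.sum_add_distrib]; exact add_le_add t1 t2)
      (by rw [Nat.le_div_iff_mul_le hB0]; omega) hCq
    rw [← hB] at s2
    have su : ∀ k, s * T ≤ k + T → k < s * T + (d + T) →
        ee f xs us x (ustar N x H) k ≤ δ := fun k k1 k2 =>
      (hρlt ee_nonneg hδ.le (lt_of_le_of_lt
        (le_add_of_nonneg_right (kinf_nonneg hρ ee_nonneg)) (s3 k k1 k2))).le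
    have st : ∀ k, s * T ≤ k + T → k < s * T + (d + T) →
        ee f xs us x (tust N x H) k ≤ δ := fun k k1 k2 =>
      (hρlt ee_nonneg hδ.le (lt_of_le_of_lt
        (le_add_of_nonneg_left (kinf_nonneg hρ ee_nonneg)) (s3 k k1 k2))).le
    -- remaining horizon
    obtain ⟨N₁, hN₁⟩ : ∃ N₁, N = s * T + N₁ := ⟨N - s * T, by omega⟩
    have hN₁B : (q + 1) * B ≤ N₁ - 1 := by omega
    -- the optimal trajectory from the steady state stays close
    set v := ustar N₁ xs (fun _ => h xs us) with hv
    have hva := (hopt N₁ xs hxsX _ hHs).1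
    have hvJ := (hopt N₁ xs hxsX _ hHs).2.1
    have hvle := hoptle N₁ xs hxsX _ hHs
    rw [← hv] at hva hvJ hvle
    have hvnear : ∀ k < d + T, ee f xs us xs v k ≤ δ₃ := by
      obtain ⟨t3, -⟩ := hC xs hxsX _ hHs N₁ (by omega)
      rw [← hv] at t3
      obtain ⟨r, r1, r2, r3⟩ := window (g := fun k => ρ (ee f xs us xs v k))
        (fun k => kinf_nonneg hρ ee_nonneg) hT
        (Q := (N₁ - 1) / B) (d := d) (C := C) (c := ρ δ) (q := q) t3
        (by rw [Nat.le_div_iff_mul_le hB0]; omega) hCq'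
      rw [← hB] at r2
      obtain ⟨M, hM⟩ : ∃ M, N₁ = r * T + M := ⟨N₁ - r * T, by omega⟩
      have hsum : ∑ k ∈ range (r * T), ρ (ee f xs us xs v k) ≤ 2 * (ρ δ₃ / 3) := by
        have hM' : d + T ≤ M := by omega
        clear_value v
        clear hN₁B hN₁ t3
        subst hM
        exact stepA hT hZ hLh hhL hzs hfix hhs hlb hlam0 hrot hδ.le (sp4.mono l6)
          (fun y hy hyd => n5 y hy (hyd.trans l7)) hva hvle hM'
          (by omega) fun k k1 k2 =>
            ((hρlt ee_nonneg hδ.le (r3 k (by omega) k2)).le)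
      intro k hk
      have h1 : ρ (ee f xs us xs v k) ≤ ∑ k ∈ range (r * T), ρ (ee f xs us xs v k) :=
        Finset.single_le_sum (f := fun k => ρ (ee f xs us xs v k))
          (fun i _ => kinf_nonneg hρ ee_nonneg) (Finset.mem_range.2 (by omega))
      exact (hρlt ee_nonneg hδ₃.le (by linarith)).le
    have hNsub : N - s * T = N₁ := by omega
    have hua := (hopt N x hx H hH).1
    have huJ := (hopt N x hx H hH).2.1
    have hule := hoptle N x hx H hH
    have hta := (htopt N x hx H hH).1
    have htle := htoptle N x hx H hH
    have hψ' := hψ (s * T - 1) (by omega) N x hx H hH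
    rw [show s * T - 1 + 1 = s * T by omega] at hψ'
    have hN₁d : d + T ≤ N₁ := by omega
    generalize ustar N x H = u at *
    generalize tust N x H = t at *
    refine ⟨s * T, by omega, by omega, ?_, ?_, ?_, ?_⟩
    · intro k hk
      rw [Finset.mem_Icc] at hk
      exact ⟨(su k (by omega) (by omega)).trans (l5.trans l4),
        (st k (by omega) (by omega)).trans (l5.trans l4)⟩
    all_goals rw [hN₁] at hua hta hule htle
    all_goals rw [hN₁] at huJ
    all_goals
      have hsp := sp1.mono l2
      have e1 : cost f ℓ x u (s * T + N₁) = cost f ℓ x u (s * T) +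
        cost f ℓ (traj f x u (s * T)) (fun j => u (s * T + j)) N₁ := sum_shift ℓ x u (s * T) N₁
      have e2 : rcost f ℓ h (ℓ xs us) lam lb x t (s * T + N₁) =
        rcost f ℓ h (ℓ xs us) lam lb x t (s * T) +
        rcost f ℓ h (ℓ xs us) lam lb (traj f x t (s * T)) (fun j => t (s * T + j)) N₁ :=
        sum_shift (rot f ℓ h (ℓ xs us) lam lb) x t (s * T) N₁
      have hXu : traj f x u (s * T) ∈ Prod.fst '' Z := ⟨_, hua.1 (s * T) (by omega), rfl⟩
      have hXt : traj f x t (s * T) ∈ Prod.fst '' Z := ⟨_, hta.1 (s * T) (by omega), rfl⟩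
      have hHu := hist_mem (k := s * T) hZ hLh hhL hzs hua (by omega) hT (by omega)
      have hHt := hist_mem (k := s * T) hZ hLh hhL hzs hta (by omega) hT (by omega)
      have htu := adm_tail hua (by omega) (by omega)
      have htt := adm_tail hta (by omega) (by omega)
      have hnu : ∀ k < d + T, ee f xs us (traj f x u (s * T)) (fun j => u (s * T + j)) k ≤ δ₃ := by
        intro k hk
        have := (su (s * T + k) (by omega) (by omega)).trans l5
        rw [ee] at this ⊢
        rwa [traj_shift]
      have hnt : ∀ k < d + T, ee f xs us (traj f x t (s * T)) (fun j => t (s * T + j)) k ≤ δ₃ := by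
        intro k hk
        have := (st (s * T + k) (by omega) (by omega)).trans l5
        rw [ee] at this ⊢
        rwa [traj_shift]
      have hpu : ∀ j ∈ Icc (s * T + 1 - T) (s * T), ee f xs us x u j ≤ δ₃ := by
        intro j hj
        rw [Finset.mem_Icc] at hj
        exact (su j (by omega) (by omega)).trans l5
      have hpt : ∀ j ∈ Icc (s * T + 1 - T) (s * T), ee f xs us x t j ≤ δ₃ := by
        intro j hj
        rw [Finset.mem_Icc] at hj
        exact (st j (by omega) (by omega)).trans l5
      have hlu := abs_le.1 (na _ hXu (((ee_le.1 (su (s * T) (by omega) (by omega))).1).trans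
        (l5.trans l1')))
      have hlt := abs_le.1 (na _ hXt (((ee_le.1 (st (s * T) (by omega) (by omega))).1).trans
        (l5.trans l1')))
    · rw [hNsub, hN₁, ← huJ, ← hvJ]
      obtain ⟨w, w1, w2, -⟩ := jc2 xs (fun _ => h xs us) (by simpa using hδ₂.le)
        (fun k _ => by simpa using (by positivity : 0 ≤ Lh * δ₂))
        N₁ _ _ _ hN₁d hXu hHu htu (fun k hk => (hnu k hk).trans l3)
      have a1 := hvle w w1
      obtain ⟨w', w1', w2', -⟩ := hsp N₁ (s * T) x H u xs (fun _ => h xs us) v hN₁d (by omega)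
        hua hpu hxsX hHs hva hvnear
      have a2 := hule w' w1'
      rw [abs_le]
      constructor <;> linarith
    · obtain ⟨w', w1', w2', -⟩ := hsp N₁ (s * T) x H t _ _ _ hN₁d (by omega)
        hta hpt hXu hHu htu hnu
      have a2 := hule w' w1'
      rw [rcost_eq]
      linarith [hlt.2]
    · obtain ⟨w', w1', -, w2'⟩ := hsp N₁ (s * T) x H u _ _ _ hN₁d (by omega)
        hua hpu hXt hHt htt hnt
      have a2 := htle w' w1'
      rw [rcost_eq x u] at w2'
      have a3 := hsum_nonpos hlb hua s (by omega)
      linarith [hlu.1]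
  obtain ⟨σ, N₅, hσ, hfin⟩ := exists_sigma _ (fun N a b hab hP => by
    intro x hx H hH
    obtain ⟨kx, k1, k2, k3, k4, k5, k6⟩ := hP x hx H hH
    exact ⟨kx, k1, k2, fun k hk => ⟨(k3 k hk).1.trans hab, (k3 k hk).2.trans hab⟩,
      k4.trans hab, k5.trans (by linarith), k6.trans hab⟩) key (T * (2 * T - 1))
  have hid : KInf (fun r => r) := ⟨continuousOn_id, strictMonoOn_id, rfl, tendsto_id⟩
  refine ⟨0, N₅, fun r => r, fun r => r, σ, hid, hid, hσ, fun x hx H hH N hN => ?_⟩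
  obtain ⟨kx, k1, k2, k3, k4, k5, k6⟩ := hfin N hN x hx H hH
  refine ⟨kx, k1, k2, k3, k4, k5, k6.trans ?_⟩
  have hT1 : (0 : ℝ) ≤ (T : ℝ) - 1 := by
    have : (1 : ℝ) ≤ T := by exact_mod_cast hT
    linarith
  have := hσ.2.1 (N - 0 - T * (2 * T - 1))
  have h9 : 0 ≤ ((T : ℝ) - 1) * ‖lb‖ * Lh * σ (N - 0 - T * (2 * T - 1)) := by positivity
  exact le_add_of_nonneg_left h9

end EMPC
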